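/- For every t ≥ 0, the solution x_t^∞ of the recursion x^∞_{t+1} = x^∞_t − (2α/(t+m+1)) x^∞_t + ((2α−1)/(t+m+1)²) x^∞_t + (1/(t+m+1)²)(a/m − a²/m²) with x^∞_0 = 0 satisfies x_t^∞ ≤ a/m − a²/m²; consequently σ_t² := (1/(t+m+1)²)[(a/m − a²/m²) − (1−α)² x_t^∞] ≥ 0. -/

import Mathlib

open MeasureTheory ProbabilityTheory Filter Topology

/-- The deterministic recursion solved by `x_t^∞`, the large-`N` limit of
`E[(Z_t(i) - Z_t)²]`. -/
noncomputable def xInf (m a : ℕ) (α : ℝ) : ℕ → ℝ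
  | 0 => 0
  | t + 1 =>
      xInf m a α t - 2 * α / ((t : ℝ) + m + 1) * xInf m a α t +
        (2 * α - 1) / ((t : ℝ) + m + 1) ^ 2 * xInf m a α t +
        1 / ((t : ℝ) + m + 1) ^ 2 * ((a : ℝ) / m - (a : ℝ) ^ 2 / m ^ 2)

/-- For every `t`, the solution `x_t^∞` of the recursion satisfies
`x_t^∞ ≤ a/m - a²/m²`; consequently
`σ_t² := (1/(t+m+1)²)[(a/m - a²/m²) - (1-α)² x_t^∞] ≥ 0`. -/
theorem xInf_le_and_sigma_sq_nonneg
    (a b m : ℕ) (ha : 1 ≤ a) (hb : 1 ≤ b) (hm : m = a + b)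
    (α : ℝ) (hα : α ∈ Set.Icc (0 : ℝ) 1) :
    ∀ t : ℕ, xInf m a α t ≤ (a : ℝ) / m - (a : ℝ) ^ 2 / m ^ 2 ∧
      0 ≤ 1 / ((t : ℝ) + m + 1) ^ 2 *
        (((a : ℝ) / m - (a : ℝ) ^ 2 / m ^ 2) - (1 - α) ^ 2 * xInf m a α t) := by
  obtain ⟨h0, h1⟩ := hα
  have hm1 : (1 : ℝ) ≤ m := by exact_mod_cast (by omega : 1 ≤ m)
  have ham : (a : ℝ) ≤ m := by exact_mod_cast (by omega : a ≤ m)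
  have hv : 0 ≤ (a : ℝ) / m - (a : ℝ) ^ 2 / m ^ 2 := by
    have e : (a : ℝ) / m - (a : ℝ) ^ 2 / m ^ 2 = (a / m) * (1 - a / m) := by ring
    rw [e]
    have h2 : (a : ℝ) / m ≤ 1 := div_le_one_of_le₀ ham (by linarith)
    have h3 : 0 ≤ (a : ℝ) / m := by positivity
    exact mul_nonneg h3 (by linarith)
  have key : ∀ t : ℕ, xInf m a α t ≤ (a : ℝ) / m - (a : ℝ) ^ 2 / m ^ 2 := by
    intro t
    induction t with
    | zero => simpa [xInf] using hv
    | succ t ih =>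
      rw [xInf]
      generalize (a : ℝ) / m - (a : ℝ) ^ 2 / m ^ 2 = v at *
      generalize xInf m a α t = x at *
      have hn : (1 : ℝ) ≤ (t : ℝ) + m + 1 := by
        have : (0 : ℝ) ≤ t := Nat.cast_nonneg t
        linarith
      generalize (t : ℝ) + m + 1 = n at *
      have hk0 : 0 ≤ n⁻¹ := by positivity
      have hk1 : n⁻¹ ≤ 1 := inv_le_one_of_one_le₀ hn
      have e : x - 2 * α / n * x + (2 * α - 1) / n ^ 2 * x + 1 / n ^ 2 * v
          = v - (1 - n⁻¹) * ((1 - n⁻¹) + 2 * (1 - α) * n⁻¹) * (v - x)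
            - 2 * α * n⁻¹ * (1 - n⁻¹) * v := by ring
      rw [e]
      have q1 : 0 ≤ 1 - n⁻¹ := by linarith
      have q2 : 0 ≤ 1 - α := by linarith
      have q3 : 0 ≤ v - x := by linarith
      have p1 : 0 ≤ (1 - n⁻¹) * ((1 - n⁻¹) + 2 * (1 - α) * n⁻¹) * (v - x) := by positivity
      have p2 : 0 ≤ 2 * α * n⁻¹ * (1 - n⁻¹) * v := by positivity
      linarith
  intro t
  refine ⟨key t, mul_nonneg (by positivity) ?_⟩
  have hx := key t
  have s1 : (1 - α) ^ 2 ≤ 1 := by nlinarith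
  have s2 := mul_le_mul_of_nonneg_left hx (sq_nonneg (1 - α))
  have s3 := mul_le_mul_of_nonneg_right s1 hv
  linarith
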